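/- Let d ≥ 2, R ≥ 1, n ≥ 1, and let f = (f_1,…,f_R) be polynomials of degree d in n variables with real coefficients, and let F = (F_1,…,F_R) be the system of their degree-d homogeneous parts. Then there exist constants C_1 ≥ 1 and C_2 > 0 depending only on f such that the following holds. For every β ∈ ℝ^R∖{0}, every real B ≥ 1, and all reals T_1,…,T_{d−1} ∈ (0, B] with T_1⋯T_{d−1} ≥ C_1·B^{d−2}, the set Z_{β,B}(T_1,…,T_{d−1}) satisfies #Z_{β,B}(T_1,…,T_{d−1}) ≤ C_2 · (B^{d−2}/(T_1⋯T_{d−1}))^{n−σ*(F)} · (T_1⋯T_{d−1})^n. -/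

import Mathlib

open MvPolynomial

noncomputable section

/-- Iterated partial derivative along a list of variable indices. -/
def iterPderiv {n : ℕ} {K : Type*} [CommSemiring K] (js : List (Fin n))
    (f : MvPolynomial (Fin n) K) : MvPolynomial (Fin n) K :=
  js.foldr (fun j g => pderiv j g) f

/-- The system of multilinear forms `m^{(f)}`. -/
def mForm {K : Type*} [CommSemiring K] (d n : ℕ) (f : MvPolynomial (Fin n) K)
    (x : Fin (d - 1) → Fin n → K) : Fin n → K :=
  fun i => ∑ j : Fin (d - 1) → Fin n,
    (∏ k, x k (j k)) * eval (0 : Fin n → K) (pderiv i (iterPderiv (List.ofFn j) f))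

/-- The `n × (d-1)n` Jacobian matrix `J^f` of `m^{(f)}`. -/
def jacMat {K : Type*} [CommSemiring K] (d n : ℕ) (f : MvPolynomial (Fin n) K)
    (x : Fin (d - 1) → Fin n → K) : Matrix (Fin n) (Fin (d - 1) × Fin n) K :=
  fun i kl => mForm d n f (Function.update x kl.1 (Pi.single kl.2 1)) i

/-- σ*(H) for a system of complex forms. -/
def sigmaStar (d n R : ℕ) (H : Fin R → MvPolynomial (Fin n) ℂ) : ℕ :=
  sSup {s : ℕ | ∃ β : Fin R → ℂ, β ≠ 0 ∧ ∃ x : Fin (d - 1) → Fin n → ℂ,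
    (∀ k, x k ≠ 0) ∧ mForm d n (∑ ρ, β ρ • H ρ) x = 0 ∧
    s = n - (jacMat d n (∑ ρ, β ρ • H ρ) x).rank}

/-- σ* for a system with real coefficients. -/
def sigmaStarR (d n R : ℕ) (F : Fin R → MvPolynomial (Fin n) ℝ) : ℕ :=
  sigmaStar d n R fun ρ => (F ρ).map (algebraMap ℝ ℂ)

/-- σ* for a system with integer coefficients. -/
def sigmaStarZ (d n R : ℕ) (F : Fin R → MvPolynomial (Fin n) ℤ) : ℕ :=
  sigmaStar d n R fun ρ => (F ρ).map (Int.castRingHom ℂ)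

/-- `‖f^{[d]}‖`. -/
def normFd (d n : ℕ) (f : MvPolynomial (Fin n) ℝ) : ℝ :=
  (d.factorial : ℝ)⁻¹ * ⨆ j : Fin d → Fin n, |eval (0 : Fin n → ℝ) (iterPderiv (List.ofFn j) f)|

/-- `N^aux_f(B)`. -/
def Naux (d n : ℕ) (g : MvPolynomial (Fin n) ℝ) (B : ℝ) : ℕ :=
  Set.ncard {x : Fin (d - 1) → Fin n → ℤ |
    (∀ k, ‖(fun i => (x k i : ℝ))‖ ≤ B) ∧
    ‖mForm d n g (fun k i => (x k i : ℝ))‖ < normFd d n g * B ^ (d - 2)}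

end

/-- Iterated partial derivatives only see the coefficients of the corresponding degree. -/
lemma coeff_iterPderiv_congr {n : ℕ} {K : Type*} [CommSemiring K] {f g : MvPolynomial (Fin n) K}
    (js : List (Fin n)) (e : ℕ)
    (h : ∀ m : Fin n →₀ ℕ, m.degree = e + js.length → coeff m f = coeff m g)
    (m : Fin n →₀ ℕ) (hm : m.degree = e) :
    coeff m (iterPderiv js f) = coeff m (iterPderiv js g) := by
  induction js generalizing e m with
  | nil => exact h m (by simpa using hm)
  | cons j js ih =>
    change coeff m (pderiv j (iterPderiv js f)) = coeff m (pderiv j (iterPderiv js g))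
    rw [coeff_pderiv, coeff_pderiv, ih (e + 1) (fun m' hm' => h m' ?_)]
    · simp [hm]
    · rw [hm', List.length_cons]; ring

/-- The coefficients of the multilinear forms attached to a polynomial. -/
noncomputable def mCoeff {K : Type*} [CommSemiring K] (d n : ℕ) (f : MvPolynomial (Fin n) K) (i : Fin n)
    (j : Fin (d - 1) → Fin n) : K :=
  eval (0 : Fin n → K) (pderiv i (iterPderiv (List.ofFn j) f))

lemma mCoeff_homogeneousComponent {K : Type*} [CommSemiring K] {d n : ℕ} (hd : 1 ≤ d)
    (f : MvPolynomial (Fin n) K) (i : Fin n) (j : Fin (d - 1) → Fin n) :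
    mCoeff d n (homogeneousComponent d f) i j = mCoeff d n f i j := by
  have key := coeff_iterPderiv_congr (f := homogeneousComponent d f) (g := f) (i :: List.ofFn j) 0
    (fun m hm => by
      rw [coeff_homogeneousComponent, if_pos]
      rw [hm]; simp; omega) 0 (by simp)
  simpa [mCoeff, eval_zero, constantCoeff_eq, iterPderiv] using key

lemma mCoeff_map {K L : Type*} [CommSemiring K] [CommSemiring L] (φ : K →+* L) (d n : ℕ)
    (f : MvPolynomial (Fin n) K) (i : Fin n) (j : Fin (d - 1) → Fin n) :
    mCoeff d n (f.map φ) i j = φ (mCoeff d n f i j) := by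
  have key : ∀ js : List (Fin n), iterPderiv js (f.map φ) = (iterPderiv js f).map φ := by
    intro js
    induction js with
    | nil => rfl
    | cons a js ih =>
      change pderiv a (iterPderiv js (f.map φ)) = (pderiv a (iterPderiv js f)).map φ
      rw [ih, pderiv_map]
  simp [mCoeff, key, pderiv_map, eval_zero, constantCoeff_map]

lemma mCoeff_sum_smul {K : Type*} [CommSemiring K] {d n R : ℕ} (β : Fin R → K)
    (f : Fin R → MvPolynomial (Fin n) K) (i : Fin n) (j : Fin (d - 1) → Fin n) :
    mCoeff d n (∑ ρ, β ρ • f ρ) i j = ∑ ρ, β ρ * mCoeff d n (f ρ) i j := by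
  have key : ∀ js : List (Fin n),
      iterPderiv js (∑ ρ, β ρ • f ρ) = ∑ ρ, β ρ • iterPderiv js (f ρ) := by
    intro js
    induction js with
    | nil => rfl
    | cons a js ih =>
      change pderiv a (iterPderiv js _) = ∑ ρ, β ρ • pderiv a (iterPderiv js (f ρ))
      rw [ih, map_sum]
      simp
  simp [mCoeff, key, map_sum]

lemma mForm_sum_smul {K : Type*} [CommSemiring K] {d n R : ℕ} (β : Fin R → K)
    (f : Fin R → MvPolynomial (Fin n) K) (x : Fin (d - 1) → Fin n → K) (i : Fin n) :
    mForm d n (∑ ρ, β ρ • f ρ) x i =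
      ∑ j : Fin (d - 1) → Fin n, (∏ k, x k (j k)) * ∑ ρ, β ρ * mCoeff d n (f ρ) i j := by
  simp only [← mCoeff_sum_smul]
  rfl

lemma mForm_complexify {d n R : ℕ} (hd : 1 ≤ d) (f : Fin R → MvPolynomial (Fin n) ℝ)
    (β : Fin R → ℝ) (x : Fin (d - 1) → Fin n → ℝ) (i : Fin n) :
    mForm d n (∑ ρ, (β ρ : ℂ) • (homogeneousComponent d (f ρ)).map (algebraMap ℝ ℂ))
      (fun k l => (x k l : ℂ)) i =
      ((mForm d n (∑ ρ, β ρ • f ρ) x i : ℝ) : ℂ) := by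
  rw [mForm_sum_smul, mForm_sum_smul]
  simp [mCoeff_map, mCoeff_homogeneousComponent hd]

lemma jacMat_complexify {d n R : ℕ} (hd : 1 ≤ d) (f : Fin R → MvPolynomial (Fin n) ℝ)
    (β : Fin R → ℝ) (x : Fin (d - 1) → Fin n → ℝ) :
    jacMat d n (∑ ρ, (β ρ : ℂ) • (homogeneousComponent d (f ρ)).map (algebraMap ℝ ℂ))
      (fun k l => (x k l : ℂ)) =
        (jacMat d n (∑ ρ, β ρ • f ρ) x).map (algebraMap ℝ ℂ) := by
  ext i ⟨k, l⟩
  simp only [jacMat, Matrix.map_apply, Complex.coe_algebraMap]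
  rw [← mForm_complexify hd]
  congr 1
  funext k' l'
  rcases eq_or_ne k' k with rfl | h
  · simp [Pi.single_apply]
    split_ifs <;> simp
  · simp [Function.update_of_ne h]

lemma mForm_update_add_smul {K : Type*} [CommSemiring K] {d n : ℕ} (f : MvPolynomial (Fin n) K)
    (x : Fin (d - 1) → Fin n → K) (k : Fin (d - 1)) (v : Fin n → K) (t : K) :
    mForm d n f (Function.update x k (x k + t • v)) =
      mForm d n f x + t • mForm d n f (Function.update x k v) := by
  funext i
  simp only [mForm, Pi.add_apply, Pi.smul_apply, smul_eq_mul, Finset.mul_sum,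
    ← Finset.sum_add_distrib]
  refine Finset.sum_congr rfl fun j _ => ?_
  let P : MultilinearMap K (fun _ : Fin (d - 1) => Fin n → K) K :=
    (MultilinearMap.mkPiAlgebra K (Fin (d - 1)) K).compLinearMap fun k => LinearMap.proj (j k)
  have hP : ∀ y, P y = ∏ k, y k (j k) := fun y => by simp [P]
  rw [← hP, ← hP, ← hP, P.map_update_add, P.map_update_smul, Function.update_eq_self, smul_eq_mul]
  ring

lemma mForm_scale {d n R : ℕ} (f : Fin R → MvPolynomial (Fin n) ℝ) (β : Fin R → ℝ)
    (x : Fin (d - 1) → Fin n → ℝ) (b : ℝ) (T : Fin (d - 1) → ℝ) :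
    mForm d n (∑ ρ, (b • β) ρ • f ρ) (fun k i => x k i / T k) =
      (b * (∏ k, T k)⁻¹) • mForm d n (∑ ρ, β ρ • f ρ) x := by
  funext i
  rw [Pi.smul_apply, mForm_sum_smul, mForm_sum_smul, smul_eq_mul, Finset.mul_sum]
  refine Finset.sum_congr rfl fun j _ => ?_
  simp only [Finset.prod_div_distrib, Pi.smul_apply, smul_eq_mul, mul_assoc, ← Finset.mul_sum]
  ring

/-- A matrix over a field has linearly independent columns, at least as many as the rank of any
base change of the matrix. -/
lemma exists_linearIndepOn_col_rank_map_le {K L m ι : Type*} [Field K] [Field L] [Fintype m]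
    [Fintype ι] (φ : K →+* L) (A : Matrix m ι K) :
    ∃ s : Finset ι, LinearIndepOn K A.col s ∧ (A.map φ).rank ≤ s.card := by
  classical
  obtain ⟨b, -, -, hspan, hli⟩ := exists_linearIndepOn_extension
    (linearIndepOn_empty K A.col) (Set.empty_subset Set.univ)
  refine ⟨b.toFinset, by simpa using hli, ?_⟩
  have hle : Submodule.span L (Set.range (A.map φ).col) ≤
      Submodule.span L ((b.toFinset.image (A.map φ).col : Finset (m → L)) : Set (m → L)) := by
    rw [Submodule.span_le]
    rintro _ ⟨c, rfl⟩
    have hc : A.col c ∈ Submodule.span K (A.col '' b) := hspan ⟨c, trivial, rfl⟩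
    have key : ∀ v ∈ Submodule.span K (A.col '' b),
        (fun i => φ (v i)) ∈ Submodule.span L ((b.toFinset.image (A.map φ).col : Finset (m → L)) : Set (m → L)) := by
      intro v hv
      induction hv using Submodule.span_induction with
      | mem v hv =>
        obtain ⟨c, hc, rfl⟩ := hv
        exact Submodule.subset_span (by
          simp only [Finset.coe_image, Set.coe_toFinset]
          exact ⟨c, hc, rfl⟩)
      | zero =>
        have h0 : (fun i => φ ((0 : m → K) i)) = 0 := funext fun i => by simp
        rw [h0]
        exact Submodule.zero_mem _
      | add v w _ _ hv hw => simpa using! Submodule.add_mem _ hv hw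
      | smul a v _ hv => simpa using! Submodule.smul_mem _ (φ a) hv
    exact key _ hc
  rw [Matrix.rank_eq_finrank_span_cols]
  exact (Submodule.finrank_mono hle).trans
    ((finrank_span_finset_le_card _).trans Finset.card_image_le)

lemma contDiff_mForm {d n R : ℕ} (f : Fin R → MvPolynomial (Fin n) ℝ) :
    ContDiff ℝ 1 fun p : (Fin R → ℝ) × (Fin (d - 1) → Fin n → ℝ) =>
      mForm d n (∑ ρ, p.1 ρ • f ρ) p.2 := by
  rw [contDiff_pi]
  intro i
  simp only [mForm_sum_smul]
  fun_prop

/-- Near a point where the columns of the Jacobian indexed by `s` are linearly independent, the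
multilinear system is bounded below along the coordinates in `s`, uniformly in the parameter. -/
lemma exists_nhds_le_norm_mForm_sub {d n R : ℕ} (f : Fin R → MvPolynomial (Fin n) ℝ)
    (p : (Fin R → ℝ) × (Fin (d - 1) → Fin n → ℝ)) (s : Finset (Fin (d - 1) × Fin n))
    (hs : LinearIndepOn ℝ (jacMat d n (∑ ρ, p.1 ρ • f ρ) p.2).col s) :
    ∃ U ∈ nhds p, ∃ c : ℝ, 0 < c ∧ ∀ β y y', (β, y) ∈ U → (β, y') ∈ U →
      (∀ k i, (k, i) ∉ s → y k i = y' k i) →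
      c * ‖y - y'‖ ≤
        ‖mForm d n (∑ ρ, β ρ • f ρ) y - mForm d n (∑ ρ, β ρ • f ρ) y'‖ := by
  set M : (Fin R → ℝ) × (Fin (d - 1) → Fin n → ℝ) → Fin n → ℝ :=
    fun p => mForm d n (∑ ρ, p.1 ρ • f ρ) p.2 with hM
  set D := fderiv ℝ M p with hD
  have hstrict : HasStrictFDerivAt M D p :=
    (contDiff_mForm f).contDiffAt.hasStrictFDerivAt (by simp)
  have hcol : ∀ k i, D (0, Pi.single k (Pi.single i 1)) =
      (jacMat d n (∑ ρ, p.1 ρ • f ρ) p.2).col (k, i) := by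
    intro k i
    refine (hstrict.hasFDerivAt.hasLineDerivAt _).unique ?_
    have hline : ∀ t : ℝ, M (p + t • (0, Pi.single k (Pi.single i 1))) =
        M p + t • (jacMat d n (∑ ρ, p.1 ρ • f ρ) p.2).col (k, i) := by
      intro t
      have h := mForm_update_add_smul (d := d) (∑ ρ, p.1 ρ • f ρ) p.2 k (Pi.single i 1) t
      have h2 : p.2 + t • (Pi.single k (Pi.single i 1) : Fin (d - 1) → Fin n → ℝ) =
          Function.update p.2 k (p.2 k + t • Pi.single i 1) := by
        funext k'
        rcases eq_or_ne k' k with rfl | hk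
        · simp
        · simp [hk]
      simp only [hM, Prod.fst_add, Prod.snd_add, Prod.smul_fst, Prod.smul_snd, smul_zero,
        add_zero, h2, h]
      rfl
    unfold HasLineDerivAt
    simp only [hline]
    simpa using ((hasDerivAt_id (0 : ℝ)).smul_const _).const_add (M p)
  let W : Submodule ℝ (Fin (d - 1) → Fin n → ℝ) :=
    { carrier := {v | ∀ k i, (k, i) ∉ s → v k i = 0}
      add_mem' := fun ha hb k i h => by simp [ha k i h, hb k i h]
      zero_mem' := fun k i _ => rfl
      smul_mem' := fun a v hv k i h => by simp [hv k i h] }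
  let L : W →ₗ[ℝ] (Fin n → ℝ) := D.toLinearMap ∘ₗ LinearMap.inr ℝ _ _ ∘ₗ W.subtype
  have hL : ∀ v : W, L v = ∑ a ∈ s, v.1 a.1 a.2 •
      (jacMat d n (∑ ρ, p.1 ρ • f ρ) p.2).col a := by
    intro v
    have hv : ((0 : Fin R → ℝ), v.1) =
        ∑ a ∈ s, v.1 a.1 a.2 • (0, Pi.single a.1 (Pi.single a.2 (1 : ℝ))) := by
      refine Prod.ext (by simp [Prod.fst_sum]) ?_
      funext k i
      simp only [Prod.snd_sum, Prod.smul_snd, Finset.sum_apply, Pi.smul_apply, smul_eq_mul]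
      rw [Finset.sum_eq_single (k, i)]
      · simp
      · rintro ⟨k', i'⟩ - hne
        rcases eq_or_ne k' k with rfl | hk
        · have : i ≠ i' := fun h => hne (by rw [h])
          simp [this]
        · simp [hk.symm]
      · intro h
        simp [v.2 k i h]
    change D (0, v.1) = _
    rw [hv, map_sum]
    simp only [map_smul, hcol]
  have hker : LinearMap.ker L = ⊥ := by
    rw [LinearMap.ker_eq_bot']
    intro v hv
    rw [hL] at hv
    have h0 := linearIndepOn_finset_iff.1 hs (fun a => v.1 a.1 a.2) hv
    ext k i
    by_cases h : (k, i) ∈ s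
    · exact h0 (k, i) h
    · exact v.2 k i h
  obtain ⟨C, hC, hanti⟩ := L.exists_antilipschitzWith hker
  have hCpos : (0 : ℝ) < C := hC
  have hc : (0 : ℝ) < (C : ℝ)⁻¹ / 2 := by positivity
  have hev := hstrict.isLittleO.def hc
  rw [nhds_prod_eq] at hev
  obtain ⟨U, hU, hUU⟩ := Filter.eventually_prod_self_iff'.1 hev
  refine ⟨U, hU, _, hc, fun β y y' hy hy' hoff => ?_⟩
  have h1 := hUU _ hy _ hy'
  let w : W := ⟨y - y', fun k i h => by simp [hoff k i h]⟩
  have h2 : ‖y - y'‖ ≤ C * ‖D (0, y - y')‖ := by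
    have := hanti.le_mul_dist w 0
    rw [dist_zero_right, map_zero, dist_zero_right] at this
    exact this
  simp only [Prod.mk_sub_mk, sub_self] at h1
  have h3 : ‖((0 : Fin R → ℝ), y - y')‖ = ‖y - y'‖ := by simp [Prod.norm_def]
  rw [h3] at h1
  have h4 : (C : ℝ)⁻¹ * ‖y - y'‖ ≤ ‖D (0, y - y')‖ := by
    rw [inv_mul_le_iff₀ hCpos]; exact h2
  have h6 : ‖D (0, y - y')‖ ≤ ‖M (β, y) - M (β, y')‖ +
      ‖M (β, y) - M (β, y') - D (0, y - y')‖ := by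
    have := norm_sub_le (M (β, y) - M (β, y')) (M (β, y) - M (β, y') - D (0, y - y'))
    simpa using this
  change _ ≤ ‖M (β, y) - M (β, y')‖
  linarith

/-- Counting integer points in a box which are confined to short intervals in the coordinates of
`s` once the remaining coordinates are fixed. -/
lemma ncard_le_prod_of_fiber_bounds {κ ι : Type*} [Fintype κ] [Fintype ι] [DecidableEq κ]
    [DecidableEq ι] (A : Set (κ → ι → ℤ)) (s : Finset (κ × ι)) (N : κ → ι → ℝ)
    (hN : ∀ k i, 0 ≤ N k i)
    (hout : ∀ x ∈ A, ∀ k i, (k, i) ∉ s → |(x k i : ℝ)| ≤ N k i)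
    (hin : ∀ x ∈ A, ∀ x' ∈ A, (∀ k i, (k, i) ∉ s → x k i = x' k i) →
      ∀ k i, (k, i) ∈ s → |(x k i : ℝ) - x' k i| ≤ N k i) :
    (A.ncard : ℝ) ≤ ∏ k, ∏ i, (2 * N k i + 1) := by
  classical
  let res : (κ → ι → ℤ) → (κ → ι → ℤ) := fun x k i => if (k, i) ∈ s then 0 else x k i
  let rep : (κ → ι → ℤ) → (κ → ι → ℤ) := fun z =>
    if h : ∃ x ∈ A, res x = z then h.choose else 0
  have hrep : ∀ x ∈ A, rep (res x) ∈ A ∧ res (rep (res x)) = res x := by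
    intro x hx
    have h : ∃ x' ∈ A, res x' = res x := ⟨x, hx, rfl⟩
    simp only [rep, dif_pos h]
    exact h.choose_spec
  have hres : ∀ x x', res x = res x' → ∀ k i, (k, i) ∉ s → x k i = x' k i := by
    intro x x' h k i hki
    simpa [res, hki] using congrFun (congrFun h k) i
  let g : (κ → ι → ℤ) → (κ → ι → ℤ) := fun x k i =>
    if (k, i) ∈ s then x k i - rep (res x) k i else x k i
  let F : Finset (κ → ι → ℤ) :=
    Fintype.piFinset fun k => Fintype.piFinset fun i => Finset.Icc (-⌊N k i⌋) ⌊N k i⌋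
  have hgF : ∀ x ∈ A, g x ∈ (F : Set (κ → ι → ℤ)) := by
    intro x hx
    simp only [F, Finset.mem_coe, Fintype.mem_piFinset, Finset.mem_Icc, ← abs_le]
    intro k i
    rw [Int.le_floor, Int.cast_abs]
    by_cases h : (k, i) ∈ s
    · simpa [g, h] using
        hin x hx _ (hrep x hx).1 (hres _ _ (hrep x hx).2.symm) k i h
    · simpa [g, h] using hout x hx k i h
  have hinj : Set.InjOn g A := by
    intro x _ x' _ h
    have hr : res x = res x' := by
      funext k i
      by_cases hk : (k, i) ∈ s
      · simp [res, hk]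
      · simpa [res, g, hk] using congrFun (congrFun h k) i
    funext k i
    have := congrFun (congrFun h k) i
    by_cases hk : (k, i) ∈ s
    · simpa [g, hk, hr] using this
    · simpa [g, hk] using this
  have hcard : A.ncard ≤ F.card := by
    rw [← Set.ncard_coe_finset]
    exact Set.ncard_le_ncard_of_injOn g hgF hinj F.finite_toSet
  calc (A.ncard : ℝ) ≤ F.card := by exact_mod_cast hcard
    _ = ∏ k, ∏ i, ((2 * ⌊N k i⌋ + 1 : ℤ) : ℝ) := by
      simp only [F, Fintype.card_piFinset, Int.card_Icc, Nat.cast_prod]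
      refine Finset.prod_congr rfl fun k _ => Finset.prod_congr rfl fun i _ => ?_
      have : 0 ≤ ⌊N k i⌋ := Int.floor_nonneg.2 (hN k i)
      rw [← Int.cast_natCast, Int.toNat_of_nonneg (by omega)]
      congr 1
      ring
    _ ≤ _ := by
      refine Finset.prod_le_prod (fun k _ => Finset.prod_nonneg fun i _ => ?_) fun k _ =>
        Finset.prod_le_prod (fun i _ => ?_) fun i _ => ?_
      · have : 0 ≤ ⌊N k i⌋ := Int.floor_nonneg.2 (hN k i)
        exact_mod_cast (by omega : (0 : ℤ) ≤ 2 * ⌊N k i⌋ + 1)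
      · have : 0 ≤ ⌊N k i⌋ := Int.floor_nonneg.2 (hN k i)
        exact_mod_cast (by omega : (0 : ℤ) ≤ 2 * ⌊N k i⌋ + 1)
      · push_cast
        linarith [Int.floor_le (N k i)]

lemma sub_sigmaStarR_le_rank {d n R : ℕ} (hd : 1 ≤ d) (f : Fin R → MvPolynomial (Fin n) ℝ)
    (β : Fin R → ℝ) (hβ : β ≠ 0) (x : Fin (d - 1) → Fin n → ℝ) (hx : ∀ k, x k ≠ 0)
    (h : mForm d n (∑ ρ, β ρ • f ρ) x = 0) :
    n - sigmaStarR d n R (fun ρ => homogeneousComponent d (f ρ)) ≤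
      ((jacMat d n (∑ ρ, β ρ • f ρ) x).map (algebraMap ℝ ℂ)).rank := by
  have hle : n - ((jacMat d n (∑ ρ, β ρ • f ρ) x).map (algebraMap ℝ ℂ)).rank ≤
      sigmaStarR d n R (fun ρ => homogeneousComponent d (f ρ)) := by
    refine le_csSup ⟨n, ?_⟩ ⟨fun ρ => (β ρ : ℂ), ?_, fun k i => (x k i : ℂ), ?_, ?_, ?_⟩
    · rintro s ⟨-, -, -, -, -, rfl⟩
      exact Nat.sub_le _ _
    · exact fun h0 => hβ (funext fun ρ => by simpa using congrFun h0 ρ)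
    · exact fun k h0 => hx k (funext fun i => by simpa using congrFun h0 i)
    · funext i
      rw [mForm_complexify hd, h]
      simp
    · rw [jacMat_complexify hd]
  omega

lemma prod_le_mul_pow_of_le {d : ℕ} {B : ℝ} (hB : 0 ≤ B) (T : Fin (d - 1) → ℝ)
    (hT : ∀ k, 0 < T k ∧ T k ≤ B) (k : Fin (d - 1)) : ∏ k, T k ≤ T k * B ^ (d - 2) := by
  rw [← Finset.mul_prod_erase _ _ (Finset.mem_univ k)]
  refine mul_le_mul_of_nonneg_left ?_ (hT k).1.le
  refine (Finset.prod_le_prod (fun i _ => (hT i).1.le) fun i _ => (hT i).2).trans_eq ?_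
  rw [Finset.prod_const, Finset.card_erase_of_mem (Finset.mem_univ k), Finset.card_univ,
    Fintype.card_fin]
  congr 1

/-- The integer points of the dyadic block whose rescaling lies in `S`. -/
def rescaledBlock (d n R : ℕ) (f : Fin R → MvPolynomial (Fin n) ℝ) (β : Fin R → ℝ) (B : ℝ)
    (T : Fin (d - 1) → ℝ) (S : Set ((Fin R → ℝ) × (Fin (d - 1) → Fin n → ℝ))) :
    Set (Fin (d - 1) → Fin n → ℤ) :=
  {x | ((∀ k, T k ≤ ‖(fun i => (x k i : ℝ))‖ ∧ ‖(fun i => (x k i : ℝ))‖ ≤ 2 * T k) ∧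
      ‖mForm d n (∑ ρ, β ρ • f ρ) (fun k i => (x k i : ℝ))‖ ≤ ‖β‖ * B ^ (d - 2)) ∧
    (‖β‖⁻¹ • β, fun k i => (x k i : ℝ) / T k) ∈ S}

lemma finite_rescaledBlock {d n R : ℕ} (f : Fin R → MvPolynomial (Fin n) ℝ) (β : Fin R → ℝ)
    (B : ℝ) (T : Fin (d - 1) → ℝ) (S : Set ((Fin R → ℝ) × (Fin (d - 1) → Fin n → ℝ))) :
    (rescaledBlock d n R f β B T S).Finite := by
  classical
  refine (Fintype.piFinset fun k => Fintype.piFinset fun _ : Fin n =>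
    Finset.Icc (-⌊2 * T k⌋) ⌊2 * T k⌋).finite_toSet.subset ?_
  rintro x ⟨⟨hx, -⟩, -⟩
  simp only [Finset.mem_coe, Fintype.mem_piFinset, Finset.mem_Icc, ← abs_le]
  intro k i
  rw [Int.le_floor, Int.cast_abs]
  exact (norm_le_pi_norm (fun i => (x k i : ℝ)) i).trans (hx k).2

lemma norm_mForm_rescaled_le {d n R : ℕ} {f : Fin R → MvPolynomial (Fin n) ℝ} {β : Fin R → ℝ}
    (hβ : β ≠ 0) {B : ℝ} {T : Fin (d - 1) → ℝ} (hT : ∀ k, 0 < T k)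
    {S : Set ((Fin R → ℝ) × (Fin (d - 1) → Fin n → ℝ))} {x : Fin (d - 1) → Fin n → ℤ}
    (hx : x ∈ rescaledBlock d n R f β B T S) :
    ‖mForm d n (∑ ρ, (‖β‖⁻¹ • β) ρ • f ρ) (fun k i => (x k i : ℝ) / T k)‖ ≤
      B ^ (d - 2) / ∏ k, T k := by
  have hP : 0 < ∏ k, T k := Finset.prod_pos fun k _ => hT k
  have hb : 0 < ‖β‖ := norm_pos_iff.2 hβ
  rw [mForm_scale f β (fun k i => (x k i : ℝ)), norm_smul, Real.norm_of_nonneg (by positivity)]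
  calc _ ≤ ‖β‖⁻¹ * (∏ k, T k)⁻¹ * (‖β‖ * B ^ (d - 2)) := by
        gcongr
        exact hx.1.2
    _ = _ := by field_simp

lemma ncard_rescaledBlock_le {d n R : ℕ} (f : Fin R → MvPolynomial (Fin n) ℝ)
    (U : Set ((Fin R → ℝ) × (Fin (d - 1) → Fin n → ℝ))) (s : Finset (Fin (d - 1) × Fin n))
    {c : ℝ} (hc : 0 < c)
    (hU : ∀ β y y', (β, y) ∈ U → (β, y') ∈ U → (∀ k i, (k, i) ∉ s → y k i = y' k i) →
      c * ‖y - y'‖ ≤ ‖mForm d n (∑ ρ, β ρ • f ρ) y - mForm d n (∑ ρ, β ρ • f ρ) y'‖)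
    {β : Fin R → ℝ} (hβ : β ≠ 0) {B : ℝ} (hB : 1 ≤ B) {T : Fin (d - 1) → ℝ}
    (hT : ∀ k, 0 < T k ∧ T k ≤ B) (hTB : B ^ (d - 2) ≤ ∏ k, T k) :
    ((rescaledBlock d n R f β B T U).ncard : ℝ) ≤
      (5 + 4 / c) ^ (n * (d - 1)) * (B ^ (d - 2) / ∏ k, T k) ^ s.card * (∏ k, T k) ^ n := by
  classical
  have hP : 0 < ∏ k, T k := Finset.prod_pos fun k _ => (hT k).1
  have hB0 : 0 < B ^ (d - 2) := by positivity
  set δ := B ^ (d - 2) / ∏ k, T k with hδ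
  have hδ0 : 0 < δ := by positivity
  have hδ1 : δ ≤ 1 := (div_le_one hP).2 hTB
  have hδT : ∀ k, 1 ≤ δ * T k := by
    intro k
    rw [hδ, div_mul_eq_mul_div, one_le_div hP, mul_comm]
    exact prod_le_mul_pow_of_le (by linarith) T hT k
  have hT1 : ∀ k, 1 ≤ T k := fun k =>
    (hδT k).trans (mul_le_of_le_one_left (hT k).1.le hδ1)
  let N : Fin (d - 1) → Fin n → ℝ := fun k i =>
    if (k, i) ∈ s then 2 * δ * T k / c else 2 * T k
  have hN0 : ∀ k i, 0 ≤ N k i := by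
    intro k i
    have := (hT k).1
    simp only [N]
    split_ifs <;> positivity
  have hcount := ncard_le_prod_of_fiber_bounds (rescaledBlock d n R f β B T U) s N hN0
    (fun x hx k i h => by
      simp only [N, h, if_false]
      exact (norm_le_pi_norm (fun i => (x k i : ℝ)) i).trans (hx.1.1 k).2)
    (fun x hx x' hx' hoff k i h => by
      simp only [N, h, if_true]
      have h1 := hU _ _ _ hx.2 hx'.2 (fun k i h => by simp only [hoff k i h])
      have h2 := (norm_sub_le _ _).trans <| add_le_add
        (norm_mForm_rescaled_le hβ (fun k => (hT k).1) hx)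
        (norm_mForm_rescaled_le hβ (fun k => (hT k).1) hx')
      have h3 : |(x k i : ℝ) / T k - x' k i / T k| ≤ 2 * δ / c := by
        rw [le_div_iff₀ hc, mul_comm]
        have h4 := (norm_le_pi_norm (((fun k i => (x k i : ℝ) / T k) -
          fun k i => (x' k i : ℝ) / T k) k) i).trans (norm_le_pi_norm _ k)
        have h5 := (mul_le_mul_of_nonneg_left h4 hc.le).trans (h1.trans h2)
        have h6 : c * |(x k i : ℝ) / T k - x' k i / T k| ≤ δ + δ := h5
        linarith
      rw [← sub_div, abs_div, abs_of_pos (hT k).1, div_le_iff₀ (hT k).1] at h3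
      exact h3.trans_eq (by ring))
  refine hcount.trans ?_
  calc ∏ k, ∏ i, (2 * N k i + 1)
      ≤ ∏ k, ∏ i : Fin n, ((5 + 4 / c) * T k * if (k, i) ∈ s then δ else 1) := by
        refine Finset.prod_le_prod
          (fun k _ => Finset.prod_nonneg fun i _ => by linarith [hN0 k i]) fun k _ =>
          Finset.prod_le_prod (fun i _ => by linarith [hN0 k i]) fun i _ => ?_
        have hTk := (hT k).1
        simp only [N]
        split_ifs with h
        · have h1 : 2 * (2 * δ * T k / c) = 4 / c * T k * δ := by ring
          have h2 := hδT k
          nlinarith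
        · have : 0 ≤ 4 / c * T k := by positivity
          have h2 := hT1 k
          nlinarith
    _ = _ := by
        have h1 : ∏ k, ∏ i : Fin n, (if (k, i) ∈ s then δ else 1) = δ ^ s.card := by
          rw [← Fintype.prod_prod_type' (fun k i => if (k, i) ∈ s then δ else 1)]
          simp [Finset.prod_ite_mem]
        simp only [Finset.prod_mul_distrib, h1, Finset.prod_const, Finset.card_univ,
          Fintype.card_fin, Finset.prod_pow, ← pow_mul]
        ring

/-- Counting points of the auxiliary inequality in a dyadic
block: if `T_1⋯T_{d-1} ≥ C₁ B^{d-2}` then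
`#Z ≪ (B^{d-2}/(T_1⋯T_{d-1}))^{n-σ*(F)}·(T_1⋯T_{d-1})^n`. -/
theorem statement6 (d R n : ℕ) (hd : 2 ≤ d) (hR : 1 ≤ R) (hn : 1 ≤ n)
    (f : Fin R → MvPolynomial (Fin n) ℝ)
    (hdeg : ∀ ρ, (f ρ).totalDegree = d) :
    ∃ C₁ C₂ : ℝ, 1 ≤ C₁ ∧ 0 < C₂ ∧
      ∀ β : Fin R → ℝ, β ≠ 0 → ∀ B : ℝ, 1 ≤ B →
      ∀ T : Fin (d - 1) → ℝ, (∀ k, 0 < T k ∧ T k ≤ B) →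
        C₁ * B ^ (d - 2) ≤ ∏ k, T k →
        (Set.ncard {x : Fin (d - 1) → Fin n → ℤ |
            (∀ k, T k ≤ ‖(fun i => (x k i : ℝ))‖ ∧ ‖(fun i => (x k i : ℝ))‖ ≤ 2 * T k) ∧
            ‖mForm d n (∑ ρ, β ρ • f ρ) (fun k i => (x k i : ℝ))‖ ≤ ‖β‖ * B ^ (d - 2)}
          : ℝ) ≤
          C₂ * (B ^ (d - 2) / ∏ k, T k) ^
              (n - sigmaStarR d n R (fun ρ => MvPolynomial.homogeneousComponent d (f ρ)))
            * (∏ k, T k) ^ n := by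
  set r := n - sigmaStarR d n R (fun ρ => MvPolynomial.homogeneousComponent d (f ρ)) with hr
  let K : Set ((Fin R → ℝ) × (Fin (d - 1) → Fin n → ℝ)) :=
    Metric.sphere 0 1 ×ˢ
      Set.univ.pi fun _ => Metric.closedBall 0 2 \ Metric.ball (0 : Fin n → ℝ) 1
  have hK : IsCompact K := (isCompact_sphere 0 1).prod
    (isCompact_univ_pi fun _ => (isCompact_closedBall 0 2).diff Metric.isOpen_ball)
  have key : ∃ C₁ C₂ : ℝ, 1 ≤ C₁ ∧ 0 < C₂ ∧
      ∀ β : Fin R → ℝ, β ≠ 0 → ∀ B : ℝ, 1 ≤ B →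
      ∀ T : Fin (d - 1) → ℝ, (∀ k, 0 < T k ∧ T k ≤ B) →
        C₁ * B ^ (d - 2) ≤ ∏ k, T k →
        ((rescaledBlock d n R f β B T K).ncard : ℝ) ≤
          C₂ * (B ^ (d - 2) / ∏ k, T k) ^ r * (∏ k, T k) ^ n := by
    refine hK.induction_on (p := fun S => ∃ C₁ C₂ : ℝ, 1 ≤ C₁ ∧ 0 < C₂ ∧
      ∀ β : Fin R → ℝ, β ≠ 0 → ∀ B : ℝ, 1 ≤ B →
      ∀ T : Fin (d - 1) → ℝ, (∀ k, 0 < T k ∧ T k ≤ B) →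
        C₁ * B ^ (d - 2) ≤ ∏ k, T k →
        ((rescaledBlock d n R f β B T S).ncard : ℝ) ≤
          C₂ * (B ^ (d - 2) / ∏ k, T k) ^ r * (∏ k, T k) ^ n) ?_ ?_ ?_ ?_
    · refine ⟨1, 1, le_rfl, one_pos, fun β _ B hB T hT _ => ?_⟩
      have hP : 0 < ∏ k, T k := Finset.prod_pos fun k _ => (hT k).1
      have he : rescaledBlock d n R f β B T ∅ = ∅ :=
        Set.eq_empty_of_forall_notMem fun x hx => hx.2
      rw [he, Set.ncard_empty, Nat.cast_zero]
      positivity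
    · rintro S S' hSS ⟨C₁, C₂, h1, h2, h⟩
      refine ⟨C₁, C₂, h1, h2, fun β hβ B hB T hT hTB => le_trans ?_ (h β hβ B hB T hT hTB)⟩
      have hsub : rescaledBlock d n R f β B T S ⊆ rescaledBlock d n R f β B T S' :=
        fun x hx => ⟨hx.1, hSS hx.2⟩
      exact_mod_cast Set.ncard_le_ncard hsub (finite_rescaledBlock f β B T S')
    · rintro S S' ⟨C₁, C₂, h1, h2, h⟩ ⟨C₁', C₂', h1', h2', h'⟩
      refine ⟨max C₁ C₁', C₂ + C₂', le_max_of_le_left h1, by positivity,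
        fun β hβ B hB T hT hTB => ?_⟩
      have hB0 : 0 < B ^ (d - 2) := by positivity
      have hS := h β hβ B hB T hT (le_trans (by gcongr; exact le_max_left _ _) hTB)
      have hS' := h' β hβ B hB T hT (le_trans (by gcongr; exact le_max_right _ _) hTB)
      have hun : rescaledBlock d n R f β B T (S ∪ S') =
          rescaledBlock d n R f β B T S ∪ rescaledBlock d n R f β B T S' := by
        ext x
        exact and_or_left
      have hcard : ((rescaledBlock d n R f β B T (S ∪ S')).ncard : ℝ) ≤
          (rescaledBlock d n R f β B T S).ncard + (rescaledBlock d n R f β B T S').ncard := by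
        rw [hun]
        exact_mod_cast Set.ncard_union_le _ _
      linarith
    · rintro p ⟨hp1, hp2⟩
      by_cases hM : mForm d n (∑ ρ, p.1 ρ • f ρ) p.2 = 0
      · obtain ⟨s, hs, hrank⟩ := exists_linearIndepOn_col_rank_map_le (algebraMap ℝ ℂ)
          (jacMat d n (∑ ρ, p.1 ρ • f ρ) p.2)
        have hp0 : p.1 ≠ 0 := by
          rintro h0
          simp [h0] at hp1
        have hy0 : ∀ k, p.2 k ≠ 0 := by
          intro k h0
          exact (hp2 k trivial).2 (by simp [h0])
        have hrs := (sub_sigmaStarR_le_rank (by omega) f p.1 hp0 p.2 hy0 hM).trans hrank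
        obtain ⟨U, hUp, c, hc, hU⟩ := exists_nhds_le_norm_mForm_sub f p s hs
        refine ⟨U, mem_nhdsWithin_of_mem_nhds hUp, 1, (5 + 4 / c) ^ (n * (d - 1)), le_rfl,
          by positivity, fun β hβ B hB T hT hTB => ?_⟩
        rw [one_mul] at hTB
        have hP : 0 < ∏ k, T k := Finset.prod_pos fun k _ => (hT k).1
        refine (ncard_rescaledBlock_le f U s hc hU hβ hB hT hTB).trans ?_
        have hδ : (B ^ (d - 2) / ∏ k, T k) ^ s.card ≤ (B ^ (d - 2) / ∏ k, T k) ^ r :=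
          pow_le_pow_of_le_one (by positivity) ((div_le_one hP).2 hTB) hrs
        gcongr
      · have hpos : 0 < ‖mForm d n (∑ ρ, p.1 ρ • f ρ) p.2‖ := norm_pos_iff.2 hM
        set η := ‖mForm d n (∑ ρ, p.1 ρ • f ρ) p.2‖ with hη
        have hU := (contDiff_mForm (d := d) f).continuous.norm.continuousAt.eventually
          (lt_mem_nhds (half_lt_self hpos) : ∀ᶠ t in nhds η, η / 2 < t)
        refine ⟨_, mem_nhdsWithin_of_mem_nhds hU, max 1 (η / 2)⁻¹, 1, le_max_left _ _, one_pos,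
          fun β hβ B hB T hT hTB => ?_⟩
        have hP : 0 < ∏ k, T k := Finset.prod_pos fun k _ => (hT k).1
        rw [Set.eq_empty_of_forall_notMem (s := rescaledBlock d n R f β B T _), Set.ncard_empty,
          Nat.cast_zero]
        · positivity
        · intro x hx
          have h1 := norm_mForm_rescaled_le hβ (fun k => (hT k).1) hx
          have h2 : B ^ (d - 2) / ∏ k, T k ≤ η / 2 := by
            rw [div_le_iff₀ hP, ← inv_mul_le_iff₀ (by positivity)]
            refine le_trans ?_ hTB
            gcongr
            exact le_max_right _ _
          exact absurd hx.2 (not_lt.2 (h1.trans h2))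
  obtain ⟨C₁, C₂, h1, h2, h⟩ := key
  refine ⟨C₁, C₂, h1, h2, fun β hβ B hB T hT hTB => le_trans ?_ (h β hβ B hB T hT hTB)⟩
  refine Nat.cast_le.2 (Set.ncard_le_ncard (fun x hx => ⟨hx, ?_, fun k _ => ?_⟩)
    (finite_rescaledBlock f β B T K))
  · simp [norm_smul, hβ]
  · have hTk := (hT k).1
    have hx := hx.1 k
    have hscale : (fun i => (x k i : ℝ) / T k) = (T k)⁻¹ • fun i => (x k i : ℝ) := by
      funext i
      simp [div_eq_inv_mul]
    have hnorm : ‖fun i => (x k i : ℝ) / T k‖ = ‖fun i => (x k i : ℝ)‖ / T k := by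
      rw [hscale, norm_smul, norm_inv, Real.norm_of_nonneg hTk.le, inv_mul_eq_div]
    simp only [Set.mem_sdiff, mem_closedBall_zero_iff, mem_ball_zero_iff, not_lt, hnorm]
    exact ⟨(div_le_iff₀ hTk).2 hx.2, (one_le_div hTk).2 hx.1⟩
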